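/- Let w ∈ W be bigrassmannian with (w, i, j) ∈ Γ(W) (so D_L(w) = {i} and D_R(w) = {j}). The following are equivalent: (1) w satisfies the orthogonality condition; (2) there is no k ∈ I and no (v, i′, j′) ∈ Γ(W) such that (w, i, j) →_{(k,R)} (v, i′, j′) or (w, i, j) →_{(k,L)} (v, i′, j′). -/

import Mathlib

open CoxeterSystem

namespace NilpotencyIndices

variable {B : Type*} {W : Type*} [Group W] {M : CoxeterMatrix B}

/-- The set `Γ(W)` of triples `(w, i, j)` with `ℓ(sᵢ w sⱼ) = ℓ(w) - 2`
(stated as `ℓ(sᵢ w sⱼ) + 2 = ℓ(w)` to avoid truncated subtraction). -/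
def InGamma (cs : CoxeterSystem M W) (x : W × B × B) : Prop :=
  cs.length (cs.simple x.2.1 * x.1 * cs.simple x.2.2) + 2 = cs.length x.1

/-- The weak left (Bruhat) order: `v ≤_L w` iff `ℓ(v) + ℓ(w v⁻¹) = ℓ(w)`. -/
def WeakLeftLE (cs : CoxeterSystem M W) (v w : W) : Prop :=
  cs.length v + cs.length (w * v⁻¹) = cs.length w

/-- The weak right (Bruhat) order: `v ≤_R w` iff `ℓ(v) + ℓ(v⁻¹ w) = ℓ(w)`. -/
def WeakRightLE (cs : CoxeterSystem M W) (v w : W) : Prop :=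
  cs.length v + cs.length (v⁻¹ * w) = cs.length w

/-- `v(α_a) = α_b`: the group-theoretic condition `v sₐ v⁻¹ = s_b` and `ℓ(v sₐ) = ℓ(v) + 1`. -/
def MapsSimple (cs : CoxeterSystem M W) (v : W) (a b : B) : Prop :=
  v * cs.simple a * v⁻¹ = cs.simple b ∧ cs.length (v * cs.simple a) = cs.length v + 1

/-- `(w, i, j) →_L (u, i', j')` iff both triples are in `Γ(W)`, `u ≤_L w`, `j' = j`, and
`(w u⁻¹)(α_{i'}) = α_i`. -/
def RedL (cs : CoxeterSystem M W) (x y : W × B × B) : Prop :=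
  InGamma cs x ∧ InGamma cs y ∧ WeakLeftLE cs y.1 x.1 ∧ y.2.2 = x.2.2 ∧
    MapsSimple cs (x.1 * y.1⁻¹) y.2.1 x.2.1

/-- `(w, i, j) →_R (u, i', j')` iff both triples are in `Γ(W)`, `u ≤_R w`, `i' = i`, and
`(u⁻¹ w)(α_j) = α_{j'}`. -/
def RedR (cs : CoxeterSystem M W) (x y : W × B × B) : Prop :=
  InGamma cs x ∧ InGamma cs y ∧ WeakRightLE cs y.1 x.1 ∧ y.2.1 = x.2.1 ∧
    MapsSimple cs (y.1⁻¹ * x.1) x.2.2 y.2.2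

/-- `→`: the reflexive-transitive closure of the union of `→_L` and `→_R`. -/
def Red (cs : CoxeterSystem M W) : (W × B × B) → (W × B × B) → Prop :=
  Relation.ReflTransGen (fun x y => RedL cs x y ∨ RedR cs x y)

/-- `↔`: the equivalence relation generated by `→`. -/
def EquivRed (cs : CoxeterSystem M W) : (W × B × B) → (W × B × B) → Prop :=
  Relation.EqvGen (Red cs)

/-- The alternating word `a, b, a, b, …` with `n` letters, starting with `a`. -/
def altWord (a b : B) : ℕ → List B
  | 0 => []
  | n + 1 => a :: altWord b a n

/-- `w₀(a, b)`: the alternating product `sₐ s_b sₐ ⋯` with `M a b` factors, the longest element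
of the subgroup generated by `sₐ` and `s_b` when `M a b` is finite (i.e. nonzero). -/
def w0 (cs : CoxeterSystem M W) (a b : B) : W :=
  cs.wordProd (altWord a b (M a b))

/-- An element is bigrassmannian if it has exactly one left descent and exactly one
right descent. -/
def Bigrassmannian (cs : CoxeterSystem M W) (w : W) : Prop :=
  (∃! i, cs.IsLeftDescent w i) ∧ (∃! j, cs.IsRightDescent w j)

/-- The support of `w`: the set of indices appearing in some reduced word for `w`. -/
def Supp (cs : CoxeterSystem M W) (w : W) : Set B :=
  {i | ∃ l : List B, cs.IsReduced l ∧ cs.wordProd l = w ∧ i ∈ l}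

/-- The relation `(w, i, j) →_{(k,L)} (u, i', j')`. -/
def RedkL (cs : CoxeterSystem M W) (k : B) (x y : W × B × B) : Prop :=
  cs.length y.1 < cs.length x.1 ∧ RedR cs (x.1 * cs.simple k, x.2.1, x.2.2) x ∧
    RedL cs (x.1 * cs.simple k, x.2.1, x.2.2) y ∧ WeakLeftLE cs y.1 x.1

/-- The relation `(w, i, j) →_{(k,R)} (u, i', j')`. -/
def RedkR (cs : CoxeterSystem M W) (k : B) (x y : W × B × B) : Prop :=
  cs.length y.1 < cs.length x.1 ∧ RedL cs (cs.simple k * x.1, x.2.1, x.2.2) x ∧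
    RedR cs (cs.simple k * x.1, x.2.1, x.2.2) y ∧ WeakRightLE cs y.1 x.1

/-- The orthogonality condition for a bigrassmannian element `w` with `D_L(w) = {i}` and
`D_R(w) = {j}`. -/
def OrthCond (cs : CoxeterSystem M W) (w : W) (i j : B) : Prop :=
  (∀ a b : B, M a j = 2 → MapsSimple cs w a b → M b i = 2) ∧
  (∀ a b : B, M a i = 2 → MapsSimple cs w⁻¹ a b → M b j = 2)

/-! ### The geometric representation -/

open Module Polynomial.Chebyshev in
/-- If `f y * g x = 4 cos² (π / m)`, then the product of the reflections `(x, f)` and `(y, g)`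
has order dividing `m`. -/
theorem reflection_mul_reflection_pow_eq_one {V : Type*} [AddCommGroup V] [Module ℝ V]
    {x y : V} {f g : Dual ℝ V} (hf : f x = 2) (hg : g y = 2) {m : ℕ} (hm : 2 ≤ m)
    (hfy : f y = -2 * Real.cos (Real.pi / m)) (hgx : g x = -2 * Real.cos (Real.pi / m)) :
    (reflection hf * reflection hg) ^ m = 1 := by
  ext z
  have ht : 2 * Real.cos (2 * (Real.pi / m)) = f y * g x - 2 := by
    rw [hfy, hgx, Real.cos_two_mul]; ring
  rcases hm.eq_or_lt with rfl | hm3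
  · have hc : Real.cos (Real.pi / (2 : ℕ)) = 0 := by simp
    rw [hc] at hfy hgx
    simp only [pow_two, LinearEquiv.mul_apply, reflection_apply, map_sub, map_smul, hf, hg, hfy,
      hgx, LinearEquiv.coe_one, id]
    module
  set θ : ℝ := 2 * (Real.pi / m) with hθ
  have hmpos : (0 : ℝ) < m := by positivity
  have hmθ : (m : ℝ) * θ = 2 * Real.pi := by rw [hθ]; field_simp
  have hsin : Real.sin θ ≠ 0 := by
    refine (Real.sin_pos_of_pos_of_lt_pi (by positivity) ?_).ne'
    have h3 : (3 : ℝ) ≤ m := by exact_mod_cast hm3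
    nlinarith [Real.pi_pos]
  have hS (n : ℤ) := S_two_mul_real_cos θ n
  rw [reflection_mul_reflection_pow_apply hf hg m z _ ht]
  rcases Nat.even_or_odd' m with ⟨k, rfl | rfl⟩
  · have h1 : (((2 * k : ℕ) : ℤ) - 2) / 2 = k - 1 := by lia
    have h2 : (((2 * k : ℕ) : ℤ) - 1) / 2 = k - 1 := by lia
    have hk : (S ℝ ((k : ℤ) - 1)).eval (2 * Real.cos θ) = 0 := by
      have := hS ((k : ℤ) - 1)
      push_cast at this hmθ
      rw [show ((k : ℝ) - 1 + 1) * θ = Real.pi by linarith, Real.sin_pi] at this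
      exact (mul_eq_zero.mp this).resolve_right hsin
    rw [h1, h2, hk]
    simp
  · have h1 : (((2 * k + 1 : ℕ) : ℤ) - 2) / 2 = k - 1 := by lia
    have h2 : (((2 * k + 1 : ℕ) : ℤ) - 1) / 2 = k := by lia
    have h3 : (((2 * k + 1 : ℕ) : ℤ) - 3) / 2 = k - 1 := by lia
    have h4 : (((2 * k + 1 : ℕ) : ℤ)) / 2 = k := by lia
    have hk : (S ℝ (k : ℤ)).eval (2 * Real.cos θ) + (S ℝ ((k : ℤ) - 1)).eval (2 * Real.cos θ)
        = 0 := by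
      have e1 := hS k
      have e2 := hS ((k : ℤ) - 1)
      push_cast at e1 e2 hmθ
      rw [show ((k : ℝ) + 1) * θ = 2 * Real.pi - (k : ℝ) * θ by linarith,
        Real.sin_two_pi_sub] at e1
      rw [show ((k : ℝ) - 1 + 1) * θ = (k : ℝ) * θ by ring] at e2
      have : ((S ℝ (k : ℤ)).eval (2 * Real.cos θ) + (S ℝ ((k : ℤ) - 1)).eval (2 * Real.cos θ))
        * Real.sin θ = 0 := by linear_combination e1 + e2
      exact (mul_eq_zero.mp this).resolve_right hsin
    rw [h1, h2, h3, h4, hk]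
    simp

/-- The linear form on `B →₀ ℝ` given by twice the pairing with the simple root `α_i`. -/
noncomputable def simpleCoroot (M : CoxeterMatrix B) (i : B) : Module.Dual ℝ (B →₀ ℝ) :=
  Finsupp.linearCombination ℝ (fun j => -2 * Real.cos (Real.pi / M i j))

theorem simpleCoroot_single (M : CoxeterMatrix B) (i j : B) :
    simpleCoroot M i (Finsupp.single j 1) = -2 * Real.cos (Real.pi / M i j) := by
  simp [simpleCoroot]

theorem simpleCoroot_self (M : CoxeterMatrix B) (i : B) :
    simpleCoroot M i (Finsupp.single i 1) = 2 := by
  simp [simpleCoroot_single]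

theorem isLiftable_reflection (M : CoxeterMatrix B) :
    M.IsLiftable (fun i => Module.reflection (simpleCoroot_self M i)) := by
  intro i i'
  by_cases hii : i = i'
  · subst hii
    rw [M.diagonal, pow_one]
    exact mul_eq_one_iff_eq_inv.mpr (Module.reflection_inv (simpleCoroot_self M i)).symm
  by_cases h0 : M i i' = 0
  · rw [h0, pow_zero]
  · have h1 := M.off_diagonal i i' hii
    refine reflection_mul_reflection_pow_eq_one _ _ (by lia) (simpleCoroot_single M i i') ?_
    rw [simpleCoroot_single, M.symmetric]

/-- Distinct commuting simple reflections are orthogonal. -/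
theorem matrix_eq_two_of_commute (cs : CoxeterSystem M W) {a b : B} (hab : a ≠ b)
    (h : cs.simple a * cs.simple b = cs.simple b * cs.simple a) : M a b = 2 := by
  have key := congrArg (cs.lift ⟨_, isLiftable_reflection M⟩) h
  simp only [map_mul, lift_apply_simple] at key
  have key := DFunLike.congr_fun (LinearEquiv.congr_fun key (Finsupp.single a 1)) b
  simp only [LinearEquiv.mul_apply, Module.reflection_apply, map_sub, map_smul,
    simpleCoroot_single, M.diagonal, Finsupp.sub_apply, Finsupp.smul_apply,
    Finsupp.single_eq_same, Finsupp.single_eq_of_ne hab.symm,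
    M.symmetric b a, smul_eq_mul, Nat.cast_one, div_one, Real.cos_pi] at key
  have hc : Real.cos (Real.pi / M a b) = 0 := by linarith
  by_contra h2
  have h1 := M.off_diagonal a b hab
  rcases Nat.eq_zero_or_pos (M a b) with h0 | h0
  · simp [h0] at hc
  · have h3 : (3 : ℝ) ≤ M a b := by exact_mod_cast (by lia : 3 ≤ M a b)
    refine (Real.cos_pos_of_mem_Ioo ⟨?_, ?_⟩).ne' hc
    · have : 0 < Real.pi / M a b := by positivity
      linarith [Real.pi_pos]
    · rw [div_lt_div_iff₀ (by linarith) (by norm_num)]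
      nlinarith [Real.pi_pos]

theorem simple_commute_of_matrix_eq_two (cs : CoxeterSystem M W) {a b : B} (h : M a b = 2) :
    cs.simple a * cs.simple b = cs.simple b * cs.simple a := by
  have := cs.simple_mul_simple_pow a b
  rw [h, pow_two, mul_eq_one_iff_eq_inv] at this
  simpa using this

/-! ### The exchange condition -/

open Classical in
/-- The action of the simple reflection `s` on `W × ZMod 2` which conjugates the first component
and changes the second one exactly when the first one is `s`. -/
noncomputable def signedConj (cs : CoxeterSystem M W) (i : B) : Equiv.Perm (W × ZMod 2) :=
  Function.Involutive.toPerm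
    (fun p => (cs.simple i * p.1 * cs.simple i, p.2 + if p.1 = cs.simple i then 1 else 0)) (by
      rintro ⟨t, ε⟩
      by_cases ht : t = cs.simple i
      · simp [ht, add_assoc, CharTwo.add_self_eq_zero]
      · have h : t * cs.simple i ≠ 1 := by rwa [Ne, mul_eq_one_iff_eq_inv, cs.inv_simple]
        simp [h, ht, mul_assoc])

open Classical in
theorem signedConj_apply (cs : CoxeterSystem M W) (i : B) (t : W) (ε : ZMod 2) :
    signedConj cs i (t, ε) =
      (cs.simple i * t * cs.simple i, ε + if t = cs.simple i then 1 else 0) := rfl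

open Classical in
theorem signedConj_mul_pow_apply (cs : CoxeterSystem M W) (i i' : B) (n : ℕ) (t : W)
    (ε : ZMod 2) :
    ((signedConj cs i * signedConj cs i') ^ n) (t, ε) =
      ((cs.simple i * cs.simple i') ^ n * t * ((cs.simple i * cs.simple i') ^ n)⁻¹,
        ε + ∑ k ∈ Finset.range (2 * n),
          if t = cs.simple i' * (cs.simple i * cs.simple i') ^ k then 1 else 0) := by
  induction n with
  | zero => simp
  | succ n ih =>
    set c := cs.simple i * cs.simple i' with hc
    have hcs (k : ℕ) : c ^ k * cs.simple i' * c ^ k = cs.simple i' := by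
      induction k with
      | zero => simp
      | succ k ihk =>
        have h1 : c * cs.simple i' * c = cs.simple i' := by simp [hc, mul_assoc]
        calc c ^ (k + 1) * cs.simple i' * c ^ (k + 1)
            = (c ^ k * c) * cs.simple i' * (c * c ^ k) := by rw [← pow_succ, ← pow_succ']
          _ = c ^ k * (c * cs.simple i' * c) * c ^ k := by simp only [mul_assoc]
          _ = _ := by rw [h1, ihk]
    have hcinv (k : ℕ) : (c ^ k)⁻¹ * cs.simple i' = cs.simple i' * c ^ k := by
      rw [inv_mul_eq_iff_eq_mul, ← mul_assoc, hcs]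
    have h1 : c ^ n * t * (c ^ n)⁻¹ = cs.simple i' ↔ t = cs.simple i' * c ^ (2 * n) := by
      rw [mul_inv_eq_iff_eq_mul, ← eq_inv_mul_iff_mul_eq, ← mul_assoc, hcinv, mul_assoc,
        ← pow_add, two_mul]
    have h2 : cs.simple i' * (c ^ n * t * (c ^ n)⁻¹) * cs.simple i' = cs.simple i ↔
        t = cs.simple i' * c ^ (2 * n + 1) := by
      have e1 : cs.simple i' * (c ^ n * t * (c ^ n)⁻¹) * cs.simple i' = cs.simple i ↔
          c ^ n * t * (c ^ n)⁻¹ = cs.simple i' * c := by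
        generalize c ^ n * t * (c ^ n)⁻¹ = x
        constructor
        · intro h
          simp [hc, ← h, mul_assoc]
        · rintro rfl
          simp [hc, mul_assoc]
      rw [e1, mul_inv_eq_iff_eq_mul, ← eq_inv_mul_iff_mul_eq, ← mul_assoc, ← mul_assoc, hcinv,
        mul_assoc, mul_assoc, ← pow_succ', ← pow_add]
      congr! 3
      ring
    rw [pow_succ', Equiv.Perm.mul_apply, ih, Equiv.Perm.mul_apply, signedConj_apply,
      signedConj_apply, show 2 * (n + 1) = 2 * n + 1 + 1 by ring, Finset.sum_range_succ,
      Finset.sum_range_succ]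
    simp only [h1, h2, Prod.mk.injEq]
    refine ⟨?_, by ring⟩
    rw [pow_succ', mul_inv_rev, hc, mul_inv_rev, cs.inv_simple, cs.inv_simple]
    simp only [mul_assoc]

theorem isLiftable_signedConj (cs : CoxeterSystem M W) : M.IsLiftable (signedConj cs) := by
  classical
  intro i i'
  ext1 ⟨t, ε⟩
  rw [signedConj_mul_pow_apply, cs.simple_mul_simple_pow, two_mul, Finset.sum_range_add]
  simp [pow_add, CharTwo.add_self_eq_zero]

open Classical in
theorem lift_signedConj_wordProd (cs : CoxeterSystem M W) (ω : List B) (t : W) (ε : ZMod 2) :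
    cs.lift ⟨_, isLiftable_signedConj cs⟩ (cs.wordProd ω) (t, ε) =
      (cs.wordProd ω * t * (cs.wordProd ω)⁻¹, ε + ((cs.rightInvSeq ω).count t : ZMod 2)) := by
  induction ω with
  | nil => simp
  | cons i ω ih =>
    have h : cs.wordProd ω * (t * (cs.wordProd ω)⁻¹) = cs.simple i ↔
        (cs.wordProd ω)⁻¹ * (cs.simple i * cs.wordProd ω) = t := by
      rw [← mul_assoc, mul_inv_eq_iff_eq_mul, ← eq_inv_mul_iff_mul_eq, eq_comm]
    rw [cs.wordProd_cons, map_mul, Equiv.Perm.mul_apply, ih, lift_apply_simple, signedConj_apply,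
      rightInvSeq, List.count_cons]
    simp [h, mul_assoc, add_assoc]

open Classical in
theorem count_leftInvSeq_eq_of_wordProd_eq (cs : CoxeterSystem M W) {ω ω' : List B}
    (h : cs.wordProd ω = cs.wordProd ω') (t : W) :
    ((cs.leftInvSeq ω).count t : ZMod 2) = (cs.leftInvSeq ω').count t := by
  have key := lift_signedConj_wordProd cs ω.reverse t 0
  rw [cs.wordProd_reverse, h, ← cs.wordProd_reverse, lift_signedConj_wordProd] at key
  simpa [rightInvSeq_reverse] using (Prod.ext_iff.mp key).2.symm

/-- The exchange condition. -/
theorem exists_simple_mul_wordProd_eq_eraseIdx (cs : CoxeterSystem M W) {ω : List B} {i : B}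
    (h : cs.IsLeftDescent (cs.wordProd ω) i) :
    ∃ r < ω.length, cs.simple i * cs.wordProd ω = cs.wordProd (ω.eraseIdx r) := by
  classical
  obtain ⟨ω', hω', he⟩ := cs.exists_isReduced (cs.simple i * cs.wordProd ω)
  have hprod : cs.wordProd (i :: ω') = cs.wordProd ω := by
    rw [cs.wordProd_cons, ← he, cs.simple_mul_simple_cancel_left]
  have hred : cs.IsReduced (i :: ω') := by
    have h1 := cs.isLeftDescent_iff.mp h
    rw [he, hω'.eq] at h1
    rw [CoxeterSystem.IsReduced, hprod, ← h1, List.length_cons]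
  have hc : (cs.leftInvSeq (i :: ω')).count (cs.simple i) = 1 :=
    List.count_eq_one_of_mem hred.nodup_leftInvSeq (by simp [leftInvSeq])
  have hmem : cs.simple i ∈ cs.leftInvSeq ω := by
    rw [← List.count_pos_iff, Nat.pos_iff_ne_zero]
    intro h0
    have := count_leftInvSeq_eq_of_wordProd_eq cs hprod (cs.simple i)
    simp [hc, h0] at this
  obtain ⟨r, hr, hre⟩ := List.mem_iff_getElem.mp hmem
  refine ⟨r, by simpa using hr, ?_⟩
  rw [← cs.getD_leftInvSeq_mul_wordProd ω r, List.getD_eq_getElem _ _ hr, hre]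

/-- If `s_b` shortens `w s_k` but neither `s_b` nor `s_k` shortens `w`, then `s_b w = w s_k`. -/
theorem simple_mul_eq_mul_simple (cs : CoxeterSystem M W) {w : W} {b k : B}
    (hb : ¬ cs.IsLeftDescent w b) (hbk : cs.IsLeftDescent (w * cs.simple k) b) :
    cs.simple b * w = w * cs.simple k := by
  obtain ⟨ω, hω, rfl⟩ := cs.exists_isReduced w
  have hcat : cs.wordProd ω * cs.simple k = cs.wordProd (ω ++ [k]) := by
    simp [cs.wordProd_append]
  rw [hcat] at hbk
  obtain ⟨r, hr, he⟩ := exists_simple_mul_wordProd_eq_eraseIdx cs hbk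
  rw [← hcat] at he
  rw [List.length_append, List.length_singleton] at hr
  rcases Nat.lt_succ_iff_lt_or_eq.mp hr with hr | rfl
  · exfalso
    rw [List.eraseIdx_append_of_lt_length hr, cs.wordProd_append, cs.wordProd_singleton,
      ← mul_assoc, mul_left_inj] at he
    apply hb
    have := cs.length_wordProd_le (ω.eraseIdx r)
    rw [List.length_eraseIdx_of_lt hr, ← he] at this
    rw [IsLeftDescent, hω.eq]
    lia
  · rw [List.eraseIdx_append_of_length_le le_rfl] at he
    simp only [Nat.sub_self, List.eraseIdx_cons_zero, List.append_nil] at he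
    exact (congrArg (cs.simple b * ·) he.symm).trans (cs.simple_mul_simple_cancel_left b)

/-! ### Elements with two left descents -/

theorem length_altWord (a b : B) (n : ℕ) : (altWord a b n).length = n := by
  induction n generalizing a b with
  | zero => rfl
  | succ n ih => simp [altWord, ih]

theorem exists_altWord_succ_eq_concat (a b : B) (n : ℕ) :
    ∃ c, altWord a b (n + 1) = altWord a b n ++ [c] := by
  induction n generalizing a b with
  | zero => exact ⟨a, rfl⟩
  | succ n ih =>
    obtain ⟨c, hc⟩ := ih b a
    exact ⟨c, by rw [altWord, hc]; rfl⟩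

/-- If `y` has `b` as a left descent and has the alternating words of length `n` in `a` and `b`
as prefixes, then either these represent the same element or the one starting with `b` can be
extended. -/
theorem altWord_prefix_succ_or_eq (cs : CoxeterSystem M W) {y : W} {a b : B} {n : ℕ}
    (hb : cs.IsLeftDescent y b)
    (hab : cs.length ((cs.wordProd (altWord a b n))⁻¹ * y) + n = cs.length y)
    (hba : cs.length ((cs.wordProd (altWord b a n))⁻¹ * y) + n = cs.length y) :
    cs.length ((cs.wordProd (altWord b a (n + 1)))⁻¹ * y) + (n + 1) = cs.length y ∨
      cs.wordProd (altWord a b n) = cs.wordProd (altWord b a n) := by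
  obtain ⟨ξ, hξ, hx⟩ := cs.exists_isReduced ((cs.wordProd (altWord a b n))⁻¹ * y)
  have hlp := length_altWord a b n
  have hy : y = cs.wordProd (altWord a b n ++ ξ) := by
    rw [cs.wordProd_append, ← hx, mul_inv_cancel_left]
  have hb' := hb
  rw [hy] at hb'
  obtain ⟨r, hr, he⟩ := exists_simple_mul_wordProd_eq_eraseIdx cs hb'
  rw [← hy] at he
  rw [List.length_append, hlp] at hr
  rw [hx, hξ.eq] at hab
  rcases lt_or_ge r n with hrn | hrn
  · right
    rw [List.eraseIdx_append_of_lt_length (by rwa [hlp]), cs.wordProd_append, ← hx, ← mul_assoc,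
      mul_left_inj, eq_mul_inv_iff_mul_eq] at he
    obtain ⟨n, rfl⟩ : ∃ k, n = k + 1 := ⟨n - 1, by lia⟩
    obtain ⟨c, hc⟩ := exists_altWord_succ_eq_concat a b n
    have hln := length_altWord a b n
    rw [hc] at he
    rcases Nat.lt_succ_iff_lt_or_eq.mp hrn with hrn | rfl
    · exfalso
      rw [List.eraseIdx_append_of_lt_length (by rwa [hln]), cs.wordProd_append,
        cs.wordProd_append, ← mul_assoc, mul_left_inj, ← cs.wordProd_cons] at he
      have h1 := cs.length_wordProd_le ((altWord a b n).eraseIdx r)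
      rw [← he, List.length_eraseIdx_of_lt (by lia), hln] at h1
      have h2 := cs.length_mul_le (cs.wordProd (b :: altWord a b n))
        ((cs.wordProd (b :: altWord a b n))⁻¹ * y)
      rw [mul_inv_cancel_left] at h2
      rw [altWord] at hba
      lia
    · rw [List.eraseIdx_append_of_length_le hln.le, hln] at he
      simp only [Nat.sub_self, List.eraseIdx_cons_zero, List.append_nil] at he
      rw [hc, altWord, cs.wordProd_cons, ← he, cs.simple_mul_simple_cancel_left]
  · left
    rw [List.eraseIdx_append_of_length_le (by lia), cs.wordProd_append, hlp] at he
    have h1 : (cs.wordProd (altWord b a (n + 1)))⁻¹ * y = cs.wordProd (ξ.eraseIdx (r - n)) := by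
      rw [altWord, cs.wordProd_cons, mul_inv_rev, cs.inv_simple, mul_assoc, he,
        inv_mul_cancel_left]
    have h2 := cs.length_wordProd_le (ξ.eraseIdx (r - n))
    rw [List.length_eraseIdx_of_lt (by lia), ← h1] at h2
    have h3 := cs.length_mul_le (cs.wordProd (altWord b a (n + 1)))
        ((cs.wordProd (altWord b a (n + 1)))⁻¹ * y)
    rw [mul_inv_cancel_left] at h3
    have h4 := cs.length_wordProd_le (altWord b a (n + 1))
    rw [length_altWord] at h4
    lia

/-- If `y` has two left descents `a` and `b`, then the braid relation between them holds in some
positive length `n`, and its two sides are a prefix of `y`. -/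
theorem exists_altWord_eq_of_isLeftDescent (cs : CoxeterSystem M W) {y : W} {a b : B}
    (ha : cs.IsLeftDescent y a) (hb : cs.IsLeftDescent y b) :
    ∃ n, 1 ≤ n ∧ cs.wordProd (altWord a b n) = cs.wordProd (altWord b a n) ∧
      cs.length ((cs.wordProd (altWord a b n))⁻¹ * y) + n = cs.length y := by
  by_contra! hne
  have key (n : ℕ) : 1 ≤ n →
      cs.length ((cs.wordProd (altWord a b n))⁻¹ * y) + n = cs.length y ∧
      cs.length ((cs.wordProd (altWord b a n))⁻¹ * y) + n = cs.length y := by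
    intro hn
    induction n, hn using Nat.le_induction with
    | base => simpa [altWord] using ⟨cs.isLeftDescent_iff.mp ha, cs.isLeftDescent_iff.mp hb⟩
    | succ n hn ih =>
      have hn' : cs.wordProd (altWord a b n) ≠ cs.wordProd (altWord b a n) :=
        fun h => hne n hn h ih.1
      exact ⟨(altWord_prefix_succ_or_eq cs ha ih.2 ih.1).resolve_right hn'.symm,
        (altWord_prefix_succ_or_eq cs hb ih.1 ih.2).resolve_right hn'⟩
  have := (key (cs.length y + 1) (by lia)).1
  lia

/-! ### Reductions -/

/-- A failure of the first half of the orthogonality condition yields a `(k, L)`-reduction. -/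
theorem exists_redkL (cs : CoxeterSystem M W) {w : W} {i j k b : B} (h : InGamma cs (w, i, j))
    (hi : cs.IsLeftDescent w i) (hj : cs.IsRightDescent w j) (hkj : M k j = 2)
    (hw : MapsSimple cs w k b) (hbi : M b i ≠ 2) :
    ∃ v i' j', RedkL cs k (w, i, j) (v, i', j') := by
  obtain ⟨hconj, hlen⟩ := hw
  have hcomm := simple_commute_of_matrix_eq_two cs hkj
  have hwk : w * cs.simple k = cs.simple b * w := by rw [← hconj]; group
  have hj' := cs.isRightDescent_iff.mp hj
  have hi' := cs.isLeftDescent_iff.mp hi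
  have hbi' : b ≠ i := by
    rintro rfl
    rw [hwk] at hlen
    lia
  have hne_comm : cs.simple b * cs.simple i ≠ cs.simple i * cs.simple b :=
    fun hc => hbi (matrix_eq_two_of_commute cs hbi' hc)
  have h' : cs.length (cs.simple i * w * cs.simple j) + 2 = cs.length w := h
  have hkj1 : cs.length (cs.simple k * cs.simple j) = cs.length (cs.simple k) + 1 := by
    refine (cs.length_mul_simple (cs.simple k) j).resolve_right fun h0 => ?_
    rw [cs.length_simple, Nat.add_eq_right, cs.length_eq_zero_iff, mul_eq_one_iff_eq_inv,
      cs.inv_simple] at h0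
    rw [h0] at hlen
    lia
  -- The element `y = w s_k s_j = s_b w s_j` has both `b` and `i` as left descents.
  set y := w * cs.simple k * cs.simple j with hy
  have hyj : y = w * cs.simple j * cs.simple k := by rw [hy, mul_assoc, hcomm, mul_assoc]
  have hyb : cs.simple b * y = w * cs.simple j := by
    rw [hy, hwk, mul_assoc, cs.simple_mul_simple_cancel_left]
  have hylen : cs.length y = cs.length w := by
    have h1 := cs.length_mul_simple (w * cs.simple j) k
    have h2 := cs.length_mul_simple (w * cs.simple k) j
    rw [← hyj] at h1
    rw [← hy] at h2
    lia
  have hyi : cs.length (cs.simple i * y) + 1 = cs.length w := by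
    have h1 := cs.length_mul_simple (cs.simple i * w * cs.simple j) k
    have h2 := cs.length_simple_mul y i
    have h3 : cs.simple i * y = cs.simple i * w * cs.simple j * cs.simple k := by
      rw [hyj]; simp only [mul_assoc]
    rw [← h3] at h1
    lia
  obtain ⟨n, hn, hbraid, hn'⟩ := exists_altWord_eq_of_isLeftDescent cs (y := y) (a := i) (b := b)
    (by rw [IsLeftDescent]; lia) (by rw [IsLeftDescent, hyb]; lia)
  obtain ⟨m, rfl⟩ : ∃ m, n = m + 2 + 1 := by
    rcases hn.eq_or_lt with rfl | h2
    · simp only [altWord, cs.wordProd_singleton] at hbraid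
      exact (hne_comm (by rw [hbraid])).elim
    rcases Nat.eq_or_lt_of_le h2 with rfl | h3
    · simp only [altWord, cs.wordProd_cons, cs.wordProd_nil, mul_one] at hbraid
      exact (hne_comm hbraid.symm).elim
    · exact ⟨n - 3, by lia⟩
  obtain ⟨t, ht⟩ := exists_altWord_succ_eq_concat b i (m + 2)
  set z := cs.wordProd (altWord b i (m + 2)) with hz
  have hiz : cs.wordProd (altWord i b (m + 2 + 1)) = cs.simple i * z := by
    rw [altWord, cs.wordProd_cons]
  have hzt : cs.simple i * z = z * cs.simple t := by
    rw [← hiz, hbraid, ht, cs.wordProd_append, cs.wordProd_singleton]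
  have hbz : cs.simple b * z = cs.wordProd (altWord i b (m + 1)) := by
    rw [hz, altWord, cs.wordProd_cons, cs.simple_mul_simple_cancel_left]
  rw [hiz] at hn'
  set x := (cs.simple i * z)⁻¹ * y with hx
  set u := z⁻¹ * (w * cs.simple k) with hu
  have hux : u = cs.simple t * x * cs.simple j := by
    rw [hu, hx, hzt, hy]
    simp [mul_assoc]
  have hxu : cs.simple t * u * cs.simple j = x := by
    rw [hux]
    simp [mul_assoc]
  have hzlen : cs.length z ≤ m + 2 := by
    simpa [length_altWord] using cs.length_wordProd_le (altWord b i (m + 2))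
  have hbzlen : cs.length (cs.simple b * z) ≤ m + 1 := by
    simpa [hbz, length_altWord] using cs.length_wordProd_le (altWord i b (m + 1))
  have hizlen : cs.length y ≤ cs.length (cs.simple i * z) + cs.length x := by
    simpa only [hx, mul_inv_cancel_left] using cs.length_mul_le (cs.simple i * z) x
  have hiz1 := cs.length_simple_mul z i
  have hzu : cs.length (w * cs.simple k) ≤ cs.length z + cs.length u := by
    simpa [hu] using cs.length_mul_le z u
  have hulen : cs.length u ≤ cs.length x + 2 := by
    have h1 := cs.length_mul_simple (cs.simple t * x) j
    have h2 := cs.length_simple_mul x t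
    rw [hux]
    lia
  have hbzu : cs.length w ≤ cs.length (cs.simple b * z) + cs.length u := by
    have h1 := cs.length_mul_le (cs.simple b * z) u
    have h2 : cs.simple b * z * u = w := by
      rw [hu, mul_assoc, mul_inv_cancel_left, hwk, cs.simple_mul_simple_cancel_left]
    rwa [h2] at h1
  have hwku : w * cs.simple k * u⁻¹ = z := by rw [hu, mul_inv_rev, inv_inv, mul_inv_cancel_left]
  have hwu : w * u⁻¹ = cs.simple b * z := by
    rw [← hwku, hwk]
    simp [mul_assoc]
  have hΓ : InGamma cs (w * cs.simple k, i, j) := by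
    have h1 : cs.simple i * (w * cs.simple k) * cs.simple j = cs.simple i * y := by
      rw [hy]; simp only [mul_assoc]
    simp only [InGamma, h1]
    lia
  refine ⟨u, t, j, ?_, ⟨hΓ, h, ?_, rfl, ?_, ?_⟩, ⟨hΓ, ?_, ?_, rfl, ?_, ?_⟩, ?_⟩
  · dsimp only
    lia
  · simp only [WeakRightLE, inv_mul_cancel_left, cs.length_simple]
    lia
  · simp only [inv_mul_cancel_left, hcomm, cs.inv_simple, cs.simple_mul_simple_cancel_right]
  · simpa only [inv_mul_cancel_left] using hkj1
  · simp only [InGamma, hxu]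
    lia
  · simp only [WeakLeftLE, hwku]
    lia
  · simp only [hwku, ← hzt, mul_inv_cancel_right]
  · simp only [hwku, ← hzt]
    lia
  · simp only [WeakLeftLE, hwu]
    lia

/-- A `(k, L)`-reduction yields a failure of the first half of the orthogonality condition. -/
theorem exists_mapsSimple_of_redkL (cs : CoxeterSystem M W) {w u : W} {i j k i' j' : B}
    (hL : ∀ c, cs.IsLeftDescent w c → c = i) (h : RedkL cs k (w, i, j) (u, i', j')) :
    ∃ b, M k j = 2 ∧ MapsSimple cs w k b ∧ M b i ≠ 2 := by
  obtain ⟨hlt, ⟨-, -, hle, -, hkj, hkj1⟩, ⟨-, -, hule, -, hz, hzlen⟩, huw⟩ := h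
  simp only [WeakRightLE, WeakLeftLE, inv_mul_cancel_left, cs.length_simple, cs.inv_simple] at *
  -- Write `w s_k = z u` and `w = z' u`.
  set z := w * cs.simple k * u⁻¹ with hzdef
  set z' := w * u⁻¹ with hz'def
  have hiz : cs.simple i * z = z * cs.simple i' := by rw [← hz, inv_mul_cancel_right]
  have descent_of_prefix {v p : W} {c : B} (hv : cs.length u + cs.length p = cs.length v)
      (hp : p = v * u⁻¹) (hc : cs.IsLeftDescent p c) : cs.IsLeftDescent v c := by
    have h1 := cs.length_mul_le (cs.simple c * p) u
    rw [hp, mul_assoc, inv_mul_cancel_right, ← hp] at h1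
    rw [IsLeftDescent] at hc ⊢
    lia
  obtain ⟨b, hb⟩ := cs.exists_leftDescent_of_ne_one (w := z) (by
    intro h1
    rw [h1, cs.length_one] at hule
    lia)
  have hbi : b ≠ i := by
    rintro rfl
    rw [IsLeftDescent, hiz] at hb
    lia
  have hbw : cs.simple b * w = w * cs.simple k :=
    simple_mul_eq_mul_simple cs (fun h1 => hbi (hL b h1)) (descent_of_prefix hule hzdef hb)
  refine ⟨b, matrix_eq_two_of_commute cs ?_ ?_, ⟨?_, hle.symm⟩, fun hbi2 => ?_⟩
  · rintro rfl
    simp at hkj1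
  · nth_rw 2 [← hkj]
    rw [cs.simple_mul_simple_cancel_right]
  · rw [← hbw, mul_inv_cancel_right]
  · obtain ⟨c, hc⟩ := cs.exists_leftDescent_of_ne_one (w := z') (by
      intro h1
      rw [h1, cs.length_one] at huw
      lia)
    obtain rfl := hL c (descent_of_prefix huw hz'def hc)
    have hcz : cs.simple c * z = cs.simple b * (cs.simple c * z') := by
      rw [hzdef, hz'def, ← hbw, ← mul_assoc (cs.simple b),
        simple_commute_of_matrix_eq_two cs hbi2]
      simp only [mul_assoc]
    have h1 := cs.length_simple_mul (cs.simple c * z') b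
    rw [← hcz, hiz] at h1
    rw [IsLeftDescent] at hc
    lia

/-! ### Passing to the inverse -/

theorem inGamma_inv_iff (cs : CoxeterSystem M W) {w : W} {i j : B} :
    InGamma cs (w⁻¹, j, i) ↔ InGamma cs (w, i, j) := by
  have h : cs.simple j * w⁻¹ * cs.simple i = (cs.simple i * w * cs.simple j)⁻¹ := by
    simp [mul_assoc]
  simp only [InGamma, h, cs.length_inv]

theorem weakRightLE_inv_iff (cs : CoxeterSystem M W) {v w : W} :
    WeakRightLE cs v⁻¹ w⁻¹ ↔ WeakLeftLE cs v w := by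
  have h : v⁻¹⁻¹ * w⁻¹ = (w * v⁻¹)⁻¹ := by simp
  simp only [WeakRightLE, WeakLeftLE, h, cs.length_inv]

theorem mapsSimple_inv_iff (cs : CoxeterSystem M W) {v : W} {a b : B} :
    MapsSimple cs v⁻¹ a b ↔ MapsSimple cs v b a := by
  have aux {v : W} {a b : B} (h : MapsSimple cs v a b) : MapsSimple cs v⁻¹ b a := by
    obtain ⟨h1, h2⟩ := h
    refine ⟨by rw [← h1]; group, ?_⟩
    rw [← cs.length_inv, ← cs.length_inv v⁻¹, mul_inv_rev, inv_inv, cs.inv_simple, ← h2, ← h1,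
      inv_mul_cancel_right]
  exact ⟨fun h => by simpa using aux h, aux⟩

theorem redR_inv_iff (cs : CoxeterSystem M W) {w u : W} {i j i' j' : B} :
    RedR cs (w⁻¹, j, i) (u⁻¹, j', i') ↔ RedL cs (w, i, j) (u, i', j') := by
  have h : u⁻¹⁻¹ * w⁻¹ = (w * u⁻¹)⁻¹ := by simp
  simp only [RedR, RedL, inGamma_inv_iff, weakRightLE_inv_iff, h, mapsSimple_inv_iff]

theorem redkL_inv_iff (cs : CoxeterSystem M W) {w u : W} {i j k i' j' : B} :
    RedkL cs k (w⁻¹, j, i) (u⁻¹, j', i') ↔ RedkR cs k (w, i, j) (u, i', j') := by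
  have h : w⁻¹ * cs.simple k = (cs.simple k * w)⁻¹ := by simp
  have h1 := redR_inv_iff cs (w := (cs.simple k * w)⁻¹) (u := u⁻¹) (i := j) (j := i)
    (i' := j') (j' := i')
  have h2 := weakRightLE_inv_iff cs (v := u⁻¹) (w := w⁻¹)
  rw [inv_inv, inv_inv] at h1 h2
  simp only [RedkL, RedkR, h, redR_inv_iff, h1, h2, cs.length_inv]

theorem exists_redkL_iff (cs : CoxeterSystem M W) {w : W} {i j : B} (h : InGamma cs (w, i, j))
    (hL : {k : B | cs.IsLeftDescent w k} = {i}) (hj : cs.IsRightDescent w j) :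
    (∃ k v i' j', RedkL cs k (w, i, j) (v, i', j')) ↔
      ¬ ∀ a b : B, M a j = 2 → MapsSimple cs w a b → M b i = 2 := by
  simp only [Set.ext_iff, Set.mem_ofPred_eq, Set.mem_singleton_iff] at hL
  push Not
  constructor
  · rintro ⟨k, v, i', j', hk⟩
    exact ⟨k, exists_mapsSimple_of_redkL cs (fun c => (hL c).mp) hk⟩
  · rintro ⟨a, b, haj, hab, hbi⟩
    exact ⟨a, exists_redkL cs h ((hL i).mpr rfl) hj haj hab hbi⟩

/-- A bigrassmannian `w` with `D_L(w) = {i}`, `D_R(w) = {j}` satisfies the orthogonality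
condition iff it admits no `(k, R)`- or `(k, L)`-reduction. -/
theorem orthogonality_iff_no_k_reduction (cs : CoxeterSystem M W) (w : W) (i j : B)
    (h : InGamma cs (w, i, j)) (hbg : Bigrassmannian cs w)
    (hL : {k : B | cs.IsLeftDescent w k} = {i})
    (hR : {k : B | cs.IsRightDescent w k} = {j}) :
    OrthCond cs w i j ↔
      ¬ ∃ (k : B) (v : W) (i' j' : B),
        RedkR cs k (w, i, j) (v, i', j') ∨ RedkL cs k (w, i, j) (v, i', j') := by
  have hi : cs.IsLeftDescent w i := by simpa using hL.ge (Set.mem_singleton i)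
  have hj : cs.IsRightDescent w j := by simpa using hR.ge (Set.mem_singleton j)
  have hleft := exists_redkL_iff cs h hL hj
  have hright := exists_redkL_iff cs (inGamma_inv_iff cs |>.mpr h)
    (by simpa only [cs.isLeftDescent_inv_iff] using hR) (cs.isRightDescent_inv_iff.mpr hi)
  have hinv : (∃ k v i' j', RedkR cs k (w, i, j) (v, i', j')) ↔
      ∃ k v i' j', RedkL cs k (w⁻¹, j, i) (v, i', j') := by
    constructor
    · rintro ⟨k, v, i', j', hk⟩
      exact ⟨k, v⁻¹, j', i', (redkL_inv_iff cs).mpr hk⟩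
    · rintro ⟨k, v, i', j', hk⟩
      exact ⟨k, v⁻¹, j', i', (redkL_inv_iff cs).mp (by rwa [inv_inv])⟩
  simp only [exists_or, hinv, hleft, hright, OrthCond]
  tauto

end NilpotencyIndices
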